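/- For all N ∈ ℕ with N ≥ 1, all 0 < a < 1, b < 1, and all n, x ∈ {0, 1, …, N}, the limit lim_{q→0⁺} Q_n^{a,b,N;q}(x) exists and equals the little 0-Jacobi function p_n^{a,b;0}(x), i.e., it equals 1 if n = 0; equals −a(1−b)/(1−a) if n = 1, x = 0 and equals 1 if n = 1, x ≥ 1; and for n ≥ 2 it equals 0 if x < n−1, equals −a/(1−a) if x = n−1, and equals 1 if x > n−1. -/

import Mathlib

open Finset Filter Topology

/-- The q-Pochhammer symbol `(c;q)_k = ∏_{j=0}^{k-1} (1 - c q^j)`. -/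
noncomputable def qPoch (q c : ℝ) (k : ℕ) : ℝ := ∏ j ∈ Finset.range k, (1 - c * q ^ j)

/-- The q-Hahn function `Q_n^{a,b,N;q}(x) =
∑_{k=0}^{n} [(q^{−n};q)_k (abq^{n−1};q)_k (q^{x−N};q)_k /
((a;q)_k (q^{−N};q)_k (q;q)_k)] q^k`. -/
noncomputable def qHahn (a b : ℝ) (N : ℕ) (q : ℝ) (n x : ℕ) : ℝ :=
  ∑ k ∈ Finset.range (n + 1),
    qPoch q (q ^ (-(n : ℤ))) k * qPoch q (a * b * q ^ ((n : ℤ) - 1)) k *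
      qPoch q (q ^ ((x : ℤ) - (N : ℤ))) k /
      (qPoch q a k * qPoch q (q ^ (-(N : ℤ))) k * qPoch q q k) * q ^ k

/-- The little 0-Jacobi function `p_n^{a,b;0}(x)`. -/
noncomputable def littleZeroJacobi (a b : ℝ) (n x : ℕ) : ℝ :=
  if n = 0 then 1
  else if x < n - 1 then 0
  else if x = n - 1 then (if n = 1 then -(a * (1 - b)) / (1 - a) else -a / (1 - a))
  else 1


noncomputable def gb (q : ℝ) : ℕ → ℕ → ℝ
  | _, 0 => 1
  | 0, _ + 1 => 0
  | k + 1, j + 1 => gb q k j + q ^ (j + 1) * gb q k (j + 1)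

lemma gb_zero_right (q : ℝ) (k : ℕ) : gb q k 0 = 1 := by cases k <;> simp [gb]

lemma gb_succ (q : ℝ) (k j : ℕ) :
    gb q (k + 1) (j + 1) = gb q k j + q ^ (j + 1) * gb q k (j + 1) := by simp [gb]

lemma gb_eq_zero (q : ℝ) (k : ℕ) : ∀ j, k < j → gb q k j = 0 := by
  induction k with
  | zero => intro j hj; obtain ⟨j, rfl⟩ := Nat.exists_eq_succ_of_ne_zero hj.ne'; simp [gb]
  | succ k ih =>
    intro j hj
    obtain ⟨j, rfl⟩ := Nat.exists_eq_succ_of_ne_zero (by omega : j ≠ 0)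
    rw [Nat.succ_eq_add_one, gb_succ, ih _ (by omega), ih _ (by omega)]; simp

lemma gb_self (q : ℝ) (k : ℕ) : gb q k k = 1 := by
  induction k with
  | zero => simp [gb]
  | succ k ih => rw [gb_succ, ih, gb_eq_zero q k (k + 1) (by omega)]; simp

lemma qPoch_succ (q c : ℝ) (k : ℕ) : qPoch q c (k + 1) = qPoch q c k * (1 - c * q ^ k) := by
  simp [qPoch, Finset.prod_range_succ]

lemma qPoch_zero (q c : ℝ) : qPoch q c 0 = 1 := by simp [qPoch]

lemma qPoch_add (q c : ℝ) (j m : ℕ) :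
    qPoch q c (j + m) = qPoch q c j * qPoch q (c * q ^ j) m := by
  simp only [qPoch, Finset.prod_range_add]
  congr 1
  refine Finset.prod_congr rfl fun i _ => ?_
  rw [pow_add]; ring

lemma qPoch_succ' (q c : ℝ) (k : ℕ) : qPoch q c (k + 1) = (1 - c) * qPoch q (c * q) k := by
  rw [add_comm, qPoch_add]; simp [qPoch]

lemma qPoch_ne_zero {q c : ℝ} (hq0 : 0 < q) (hq1 : q < 1) (hc : c < 1) (k : ℕ) :
    qPoch q c k ≠ 0 := by
  refine Finset.prod_ne_zero_iff.2 fun j _ => ?_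
  have h1 : q ^ j ≤ 1 := pow_le_one₀ hq0.le hq1.le
  have h2 : 0 < q ^ j := pow_pos hq0 j
  rcases le_or_gt c 0 with h | h
  · nlinarith
  · nlinarith

lemma gb_ratio (q : ℝ) (s : ℕ) : ∀ j m, j + m = s →
    gb q (j + m) j * (qPoch q q j * qPoch q q m) = qPoch q q (j + m) := by
  induction s with
  | zero =>
    intro j m h
    obtain ⟨rfl, rfl⟩ : j = 0 ∧ m = 0 := by omega
    simp [qPoch, gb]
  | succ s ih =>
    intro j m h
    rcases j with _ | j
    · simp [gb_zero_right, qPoch_zero]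
    rcases m with _ | m
    · simp [gb_self, qPoch_zero]
    have h1 := ih j (m + 1) (by omega)
    have h2 := ih (j + 1) m (by omega)
    have e : j + 1 + (m + 1) = (j + (m + 1)) + 1 := by ring
    have e2 : j + 1 + m = j + (m + 1) := by ring
    rw [e, gb_succ, qPoch_succ _ _ (j + (m + 1)), ← h1]
    rw [e2, ← h1] at h2
    rw [qPoch_succ _ _ j] at *
    rw [qPoch_succ _ _ m] at *
    linear_combination (1 - q * q ^ m) * q ^ (j + 1) * h2

lemma gb_pascal {q : ℝ} (hq0 : 0 < q) (hq1 : q < 1) (j m : ℕ) :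
    gb q (j + m + 1) (j + 1) = gb q (j + m) (j + 1) + q ^ m * gb q (j + m) j := by
  rcases m with _ | m
  · simp [gb_self, gb_eq_zero]
  have n1 := qPoch_ne_zero hq0 hq1 hq1 (j + 1)
  have n2 := qPoch_ne_zero hq0 hq1 hq1 (m + 1)
  have h0 := gb_ratio q _ (j + 1) (m + 1) rfl
  have h1 := gb_ratio q _ j (m + 1) rfl
  have h2 := gb_ratio q _ (j + 1) m rfl
  have e : j + 1 + (m + 1) = (j + (m + 1)) + 1 := by ring
  have e2 : j + 1 + m = j + (m + 1) := by ring
  rw [e, qPoch_succ _ _ (j + (m + 1))] at h0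
  rw [e2] at h2
  refine mul_right_cancel₀ (mul_ne_zero n1 n2) ?_
  rw [h0]
  rw [qPoch_succ _ _ j] at *
  rw [qPoch_succ _ _ m] at *
  linear_combination -(1 - q * q ^ m) * h2 - q ^ (m + 1) * (1 - q * q ^ j) * h1

/-- first q-Chu-Vandermonde -/
lemma qcv1 {q : ℝ} (hq0 : 0 < q) (hq1 : q < 1) (B : ℝ) (k : ℕ) : ∀ a : ℝ, a < 1 →
    ∑ j ∈ range (k + 1), gb q k j * ((-1) ^ j * q ^ (j.choose 2)) *
      (∏ i ∈ range j, (B - a * q ^ i)) / qPoch q a j = qPoch q B k / qPoch q a k := by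
  induction k with
  | zero => intro a _; simp [gb, qPoch]
  | succ k ih =>
    intro a ha
    have haq : a * q < 1 := by
      rcases le_or_gt a 0 with h | h <;> nlinarith
    have hn : 1 - a ≠ 0 := by linarith
    have key : ∑ j ∈ range (k + 1 + 1), gb q (k + 1) j * ((-1) ^ j * q ^ (j.choose 2)) *
        (∏ i ∈ range j, (B - a * q ^ i)) / qPoch q a j =
        (∑ j ∈ range (k + 1), gb q k j * ((-1) ^ j * q ^ (j.choose 2)) *
          (∏ i ∈ range j, (B - a * q ^ i)) / qPoch q a j)
        - q ^ k * (B - a) / (1 - a) *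
          ∑ j ∈ range (k + 1), gb q k j * ((-1) ^ j * q ^ (j.choose 2)) *
          (∏ i ∈ range j, (B - a * q * q ^ i)) / qPoch q (a * q) j := by
      have x1 : ∑ j ∈ range (k + 1), gb q k j * ((-1) ^ j * q ^ (j.choose 2)) *
          (∏ i ∈ range j, (B - a * q ^ i)) / qPoch q a j =
          ∑ j ∈ range (k + 1 + 1), gb q k j * ((-1) ^ j * q ^ (j.choose 2)) *
          (∏ i ∈ range j, (B - a * q ^ i)) / qPoch q a j := by
        rw [sum_range_succ _ (k + 1), gb_eq_zero q k (k + 1) (by omega)]; simp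
      rw [x1, sum_range_succ', sum_range_succ' _ (k + 1), mul_sum, add_sub_right_comm,
        ← sum_sub_distrib]
      congr 1
      · refine sum_congr rfl fun j hj => ?_
        obtain ⟨m, rfl⟩ := Nat.exists_eq_add_of_le (Nat.lt_succ_iff.1 (mem_range.1 hj))
        rw [gb_pascal hq0 hq1, prod_range_succ', qPoch_succ', Nat.choose_succ_succ' j 1,
          Nat.choose_one_right]
        have hp := qPoch_ne_zero hq0 hq1 haq j
        have : ∏ i ∈ range j, (B - a * q ^ (i + 1)) = ∏ i ∈ range j, (B - a * q * q ^ i) :=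
          prod_congr rfl fun i _ => by ring
        rw [this]
        field_simp
        ring
      · simp [gb_zero_right]
    rw [key, ih a ha, ih (a * q) haq]
    have p1 := qPoch_ne_zero hq0 hq1 ha (k + 1)
    have p2 := qPoch_ne_zero hq0 hq1 ha k
    have p3 := qPoch_ne_zero hq0 hq1 haq k
    have e1 := qPoch_succ' q a k
    have e2 := qPoch_succ q a k
    rw [qPoch_succ q B]
    have s1 : qPoch q B k / qPoch q a k = qPoch q B k * (1 - a * q ^ k) / qPoch q a (k + 1) := by
      rw [div_eq_div_iff p2 p1, e2]; ring
    have s2 : q ^ k * (B - a) / (1 - a) * (qPoch q B k / qPoch q (a * q) k) =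
        q ^ k * (B - a) * qPoch q B k / qPoch q a (k + 1) := by
      rw [e1]; field_simp
    rw [s1, s2, ← sub_div]; congr 1; ring

/-- second q-Chu-Vandermonde -/
lemma qcv2 {q : ℝ} (hq0 : 0 < q) (p : ℕ) : ∀ C D : ℝ, qPoch q D p ≠ 0 →
    ∑ m ∈ range (p + 1), gb q p m * ((-1) ^ m * q ^ (m.choose 2)) *
      (q ^ m * (q⁻¹ ^ p) ^ m) * qPoch q C m / qPoch q D m =
    (∏ i ∈ range p, (C - D * q ^ i)) / qPoch q D p := by
  induction p with
  | zero => intro C D _; simp [gb, qPoch]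
  | succ p ih =>
    intro C D hD
    have e1 := qPoch_succ' q D p
    have e2 := qPoch_succ q D p
    have p2 : qPoch q D p ≠ 0 := by intro h; rw [e2, h] at hD; simp at hD
    have p3 : qPoch q (D * q) p ≠ 0 := by intro h; rw [e1, h] at hD; simp at hD
    have hn : 1 - D ≠ 0 := by intro h; rw [e1, h] at hD; simp at hD
    have hq : q ≠ 0 := hq0.ne'
    have key : ∑ m ∈ range (p + 1 + 1), gb q (p + 1) m * ((-1) ^ m * q ^ (m.choose 2)) *
      (q ^ m * (q⁻¹ ^ (p + 1)) ^ m) * qPoch q C m / qPoch q D m =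
        (∑ m ∈ range (p + 1), gb q p m * ((-1) ^ m * q ^ (m.choose 2)) *
      (q ^ m * (q⁻¹ ^ p) ^ m) * qPoch q C m / qPoch q D m)
        - q⁻¹ ^ p * (1 - C) / (1 - D) *
          ∑ m ∈ range (p + 1), gb q p m * ((-1) ^ m * q ^ (m.choose 2)) *
      (q ^ m * (q⁻¹ ^ p) ^ m) * qPoch q (C * q) m / qPoch q (D * q) m := by
      have x1 : ∑ m ∈ range (p + 1), gb q p m * ((-1) ^ m * q ^ (m.choose 2)) *
      (q ^ m * (q⁻¹ ^ p) ^ m) * qPoch q C m / qPoch q D m =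
          ∑ m ∈ range (p + 1 + 1), gb q p m * ((-1) ^ m * q ^ (m.choose 2)) *
      (q ^ m * (q⁻¹ ^ p) ^ m) * qPoch q C m / qPoch q D m := by
        rw [sum_range_succ _ (p + 1), gb_eq_zero q p (p + 1) (by omega)]; simp
      rw [x1, sum_range_succ', sum_range_succ' _ (p + 1), mul_sum, add_sub_right_comm,
        ← sum_sub_distrib]
      congr 1
      · refine sum_congr rfl fun m hm => ?_
        rw [gb_succ, qPoch_succ', qPoch_succ', Nat.choose_succ_succ' m 1,
          Nat.choose_one_right]
        have t : q ^ (m + 1) * (q⁻¹ ^ (p + 1)) ^ (m + 1) = (q⁻¹ ^ p) ^ m * q⁻¹ ^ p := by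
          rw [← pow_succ, pow_succ q⁻¹ p, mul_pow, mul_left_comm, ← mul_pow, mul_inv_cancel₀ hq]
          simp
        rw [t]
        rw [show (q⁻¹ ^ p) ^ (m + 1) = (q⁻¹ ^ p) ^ m * q⁻¹ ^ p from pow_succ _ _]
        generalize q⁻¹ ^ p = r
        rw [mul_div_mul_comm, mul_comm D q] 
        simp only [div_eq_mul_inv, mul_inv]
        ring
      · simp [gb_zero_right]
    rw [key, ih C D p2, ih (C * q) (D * q) p3]
    have pr : ∏ i ∈ range p, (C * q - D * q * q ^ i) = q ^ p * ∏ i ∈ range p, (C - D * q ^ i) := by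
      rw [← card_range p, ← prod_const, card_range, ← prod_mul_distrib]
      exact prod_congr rfl fun i _ => by ring
    rw [pr, prod_range_succ]
    generalize (∏ i ∈ range p, (C - D * q ^ i)) = Z
    have s1 : Z / qPoch q D p = Z * (1 - D * q ^ p) / qPoch q D (p + 1) := by
      rw [div_eq_div_iff p2 hD, e2]; ring
    have s2 : q⁻¹ ^ p * (1 - C) / (1 - D) * (q ^ p * Z / qPoch q (D * q) p) =
        (1 - C) * Z / qPoch q D (p + 1) := by
      rw [e1, inv_pow]; field_simp
    rw [s1, s2, ← sub_div]; congr 1; ring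

noncomputable def rr (q : ℝ) (m k : ℕ) : ℝ := ∏ i ∈ range k, (q ^ (m - i) - 1)

lemma rr_succ (q : ℝ) (m k : ℕ) : rr q m (k + 1) = rr q m k * (q ^ (m - k) - 1) := by
  simp [rr, prod_range_succ]

lemma rr_eq_zero (q : ℝ) {m k : ℕ} (h : m < k) : rr q m k = 0 :=
  prod_eq_zero (mem_range.2 h) (by simp)

lemma rr_ne_zero {q : ℝ} (hq0 : 0 < q) (hq1 : q < 1) {m k : ℕ} (h : k ≤ m) : rr q m k ≠ 0 := by
  refine prod_ne_zero_iff.2 fun i hi => ?_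
  have := mem_range.1 hi
  have : q ^ (m - i) < 1 := pow_lt_one₀ hq0.le hq1 (by omega)
  linarith

lemma qPoch_neg {q : ℝ} (hq0 : 0 < q) (m k : ℕ) :
    qPoch q (q ^ (-(m : ℤ))) k * q ^ (m * k) = rr q m k * q ^ (k.choose 2) := by
  have hq : q ≠ 0 := hq0.ne'
  induction k with
  | zero => simp [rr, qPoch]
  | succ k ih =>
    rw [qPoch_succ, rr_succ, Nat.choose_succ_succ' k 1, Nat.choose_one_right]
    rcases le_or_gt k m with h | h
    · obtain ⟨d, rfl⟩ := Nat.exists_eq_add_of_le h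
      have e : (1 - q ^ (-((k + d : ℕ) : ℤ)) * q ^ k) * q ^ (k + d)
          = (q ^ (k + d - k) - 1) * q ^ k := by
        rw [zpow_neg, zpow_natCast, Nat.add_sub_cancel_left, pow_add]; field_simp
      rw [mul_add_one, pow_add _ ((k + d) * k), pow_add _ k]
      linear_combination (1 - q ^ (-((k + d : ℕ) : ℤ)) * q ^ k) * q ^ (k + d) * ih +
        rr q (k + d) k * q ^ (k.choose 2) * e
    · rw [rr_eq_zero q h, zero_mul] at ih
      have : qPoch q (q ^ (-(m : ℤ))) k = 0 := by
        rcases mul_eq_zero.1 ih with h | h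
        · exact h
        · exact absurd h (pow_ne_zero _ hq)
      rw [this, rr_eq_zero q h]; simp

lemma qPoch_neg' {q : ℝ} (hq0 : 0 < q) (m k : ℕ) :
    qPoch q (q ^ (-(m : ℤ))) k = rr q m k * (q ^ (k.choose 2) * (q⁻¹ ^ m) ^ k) := by
  have h := qPoch_neg hq0 m k
  have hq : q ^ (m * k) ≠ 0 := pow_ne_zero _ hq0.ne'
  rw [← mul_assoc, ← h, ← pow_mul, inv_pow, mul_assoc, mul_inv_cancel₀ hq, mul_one]

lemma qPoch_neg_ne_zero {q : ℝ} (hq0 : 0 < q) (hq1 : q < 1) {m k : ℕ} (h : k ≤ m) :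
    qPoch q (q ^ (-(m : ℤ))) k ≠ 0 := by
  rw [qPoch_neg' hq0]
  have := rr_ne_zero hq0 hq1 h
  have := hq0.ne'
  positivity

lemma rr_poch (q : ℝ) (l m : ℕ) :
    rr q (m + l) m * qPoch q q l = (-1) ^ m * qPoch q q (m + l) := by
  induction m with
  | zero => simp [rr]
  | succ m ih =>
    have e : rr q (m + 1 + l) (m + 1) = rr q (m + l) m * (q ^ (m + 1 + l) - 1) := by
      unfold rr
      rw [prod_range_succ']
      congr 1
      exact prod_congr rfl fun i _ => by congr 2; omega
    rw [e, show m + 1 + l = m + l + 1 by ring, qPoch_succ]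
    linear_combination (q ^ (m + l + 1) - 1) * ih

lemma qPoch_gb {q : ℝ} (hq0 : 0 < q) (hq1 : q < 1) {p m : ℕ} (h : m ≤ p) :
    qPoch q (q ^ (-(p : ℤ))) m =
      gb q p m * ((-1) ^ m * q ^ (m.choose 2)) * (q⁻¹ ^ p) ^ m * qPoch q q m := by
  obtain ⟨l, rfl⟩ := Nat.exists_eq_add_of_le h
  rw [qPoch_neg' hq0]
  have h1 := rr_poch q l m
  have h2 := gb_ratio q _ m l rfl
  have n2 := qPoch_ne_zero hq0 hq1 hq1 l
  have : rr q (m + l) m = (-1) ^ m * gb q (m + l) m * qPoch q q m := by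
    refine mul_right_cancel₀ n2 ?_
    rw [h1, ← h2]; ring
  rw [this]; ring

lemma prod_CD (q : ℝ) (x y j p : ℕ) :
    ∏ i ∈ range p, (q ^ (-(y : ℤ)) * q ^ j - q ^ (-((x + y : ℕ) : ℤ)) * q ^ j * q ^ i) =
    (q ^ j * q⁻¹ ^ y) ^ p * qPoch q (q ^ (-(x : ℤ))) p := by
  unfold qPoch
  conv_rhs => rw [← card_range p, ← prod_const, card_range, ← prod_mul_distrib]
  refine prod_congr rfl fun i _ => ?_
  simp only [zpow_neg, zpow_natCast, inv_pow, pow_add, mul_inv]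
  ring

lemma qHahn_inner_sum {q : ℝ} (hq0 : 0 < q) (hq1 : q < 1) (x y j p : ℕ) (h : j + p ≤ x + y) :
    ∑ k ∈ range (j + p + 1), qPoch q (q ^ (-((j + p : ℕ) : ℤ))) k * qPoch q (q ^ (-(y : ℤ))) k /
      (qPoch q (q ^ (-((x + y : ℕ) : ℤ))) k * qPoch q q k) * q ^ k * gb q k j =
    qPoch q (q ^ (-((j + p : ℕ) : ℤ))) j * qPoch q (q ^ (-(y : ℤ))) j * q ^ j *
      ((q ^ j * q⁻¹ ^ y) ^ p * qPoch q (q ^ (-(x : ℤ))) p) /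
      (qPoch q (q ^ (-((x + y : ℕ) : ℤ))) (j + p) * qPoch q q j) := by
  have hD := qPoch_neg_ne_zero hq0 hq1 h
  have hq : q ≠ 0 := hq0.ne'
  rw [qPoch_add] at hD
  have hD1 := left_ne_zero_of_mul hD
  have hD2 := right_ne_zero_of_mul hD
  rw [add_assoc, sum_range_add, sum_eq_zero, zero_add]
  swap
  · intro k hk
    rw [gb_eq_zero q k j (mem_range.1 hk), mul_zero]
  have cv := qcv2 hq0 p (q ^ (-(y : ℤ)) * q ^ j) (q ^ (-((x + y : ℕ) : ℤ)) * q ^ j) hD2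
  rw [prod_CD] at cv
  rw [qPoch_add _ _ j p]
  set E := (q ^ j * q⁻¹ ^ y) ^ p * qPoch q (q ^ (-(x : ℤ))) p with hE
  have hj := qPoch_ne_zero hq0 hq1 hq1 j
  have step : ∀ m ∈ range (p + 1),
      qPoch q (q ^ (-((j + p : ℕ) : ℤ))) (j + m) * qPoch q (q ^ (-(y : ℤ))) (j + m) /
      (qPoch q (q ^ (-((x + y : ℕ) : ℤ))) (j + m) * qPoch q q (j + m)) * q ^ (j + m) *
        gb q (j + m) j =
      qPoch q (q ^ (-((j + p : ℕ) : ℤ))) j * qPoch q (q ^ (-(y : ℤ))) j * q ^ j /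
        (qPoch q (q ^ (-((x + y : ℕ) : ℤ))) j * qPoch q q j) *
      (gb q p m * ((-1) ^ m * q ^ (m.choose 2)) *
      (q ^ m * (q⁻¹ ^ p) ^ m) * qPoch q (q ^ (-(y : ℤ)) * q ^ j) m /
        qPoch q (q ^ (-((x + y : ℕ) : ℤ)) * q ^ j) m) := by
    intro m hm
    have hmp : m ≤ p := by have := mem_range.1 hm; omega
    have r := gb_ratio q _ j m rfl
    have hm' := qPoch_ne_zero hq0 hq1 hq1 m
    have hjm := qPoch_ne_zero hq0 hq1 hq1 (j + m)
    have hg : gb q (j + m) j / qPoch q q (j + m) = 1 / (qPoch q q j * qPoch q q m) := by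
      rw [div_eq_div_iff hjm (mul_ne_zero hj hm'), one_mul, r]
    have e : q ^ (-((j + p : ℕ) : ℤ)) * q ^ j = q ^ (-(p : ℤ)) := by
      simp only [zpow_neg, zpow_natCast, pow_add]; field_simp
    rw [qPoch_add _ _ j m, qPoch_add _ (q ^ (-(y : ℤ))) j m,
      qPoch_add _ (q ^ (-((x + y : ℕ) : ℤ))) j m, e, qPoch_gb hq0 hq1 hmp]
    have lhs : ∀ X Y W : ℝ, X / (Y * qPoch q q (j + m)) * W * gb q (j + m) j =
        X / Y * W * (gb q (j + m) j / qPoch q q (j + m)) := by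
      intro X Y W; rw [div_mul_eq_div_div]; ring
    rw [lhs, hg, pow_add]
    have h2 : qPoch q q m * (qPoch q q m)⁻¹ = 1 := mul_inv_cancel₀ hm'
    simp only [div_eq_mul_inv, mul_inv]
    generalize (qPoch q (q ^ (-((x + y : ℕ) : ℤ)) * q ^ j) m)⁻¹ = z1
    generalize (qPoch q (q ^ (-((x + y : ℕ) : ℤ))) j)⁻¹ = z2
    generalize (qPoch q q m)⁻¹ = z3 at *
    generalize (qPoch q q j)⁻¹ = z4
    generalize gb q p m = z5
    generalize qPoch q q m = z6 at *
    generalize qPoch q (q ^ (-(y : ℤ)) * q ^ j) m = z7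
    generalize qPoch q (q ^ (-(y : ℤ))) j = z8
    generalize qPoch q (q ^ (-((j + p : ℕ) : ℤ))) j = z9
    generalize (q⁻¹ ^ p) ^ m = z10
    linear_combination (z9 * (z5 * ((-1) ^ m * q ^ (m.choose 2)) * z10) * z8 * z7 * z2 * z1 *
      q ^ j * q ^ m * z4) * h2
  rw [sum_congr rfl step, ← mul_sum, cv]
  rw [div_mul_div_comm]
  congr 1
  ring

lemma P_eq {q : ℝ} (hq0 : 0 < q) (a b : ℝ) (n j : ℕ) (h : j ≤ n) :
    ∏ i ∈ range j, (a * b * q ^ ((n : ℤ) - 1) - a * q ^ i) =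
      q ^ (j.choose 2) * ∏ i ∈ range j, (a * b * q ^ (n - 1 - i) - a) := by
  have hs : q ^ (j.choose 2) = ∏ i ∈ range j, q ^ i := by
    rw [prod_pow_eq_pow_sum, sum_range_id, Nat.choose_two_right]
  rw [hs, ← prod_mul_distrib]
  refine prod_congr rfl fun i hi => ?_
  have hi := mem_range.1 hi
  have : q ^ ((n : ℤ) - 1) = q ^ i * q ^ (n - 1 - i) := by
    rw [← pow_add, ← zpow_natCast]; congr 1; omega
  rw [this]; ring

noncomputable def tt (a b : ℝ) (n x y j : ℕ) (q : ℝ) : ℝ :=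
  (-1) ^ j * q ^ (j.choose 2 + j * (j + x - n)) * rr q n j * rr q y j * rr q x (n - j) /
    rr q (x + y) n * (∏ i ∈ range j, (a * b * q ^ (n - 1 - i) - a)) /
    (qPoch q a j * qPoch q q j)

lemma two_choose (k : ℕ) : 2 * (k.choose 2 : ℤ) + k = k * k := by
  induction k with
  | zero => simp
  | succ k ih => rw [Nat.choose_succ_succ' k 1, Nat.choose_one_right]; push_cast; linarith

lemma pow_id {q : ℝ} (hq0 : 0 < q) (j p d y : ℕ) :
    q ^ (j.choose 2) * q ^ (j.choose 2) * (q ^ (j.choose 2) * (q⁻¹ ^ (j + p)) ^ j) *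
      (q ^ (j.choose 2) * (q⁻¹ ^ y) ^ j) * q ^ j *
      ((q ^ j * q⁻¹ ^ y) ^ p * (q ^ (p.choose 2) * (q⁻¹ ^ (p + d)) ^ p)) =
    q ^ (j.choose 2 + j * d) *
      (q ^ ((j + p).choose 2) * (q⁻¹ ^ (p + d + y)) ^ (j + p)) := by
  have hq : q ≠ 0 := hq0.ne'
  have h2 := two_choose j
  have h1 : ((j + p).choose 2 : ℤ) = j.choose 2 + p.choose 2 + j * p := by
    have h3 := two_choose p
    have h4 := two_choose (j + p)
    push_cast at h4
    linarith
  simp only [mul_pow, ← pow_mul, inv_pow]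
  simp only [← zpow_natCast, ← zpow_neg, ← zpow_add₀ hq]
  congr 1
  push_cast
  rw [h1]
  linear_combination h2

lemma qHahn_eq {q : ℝ} (hq0 : 0 < q) (hq1 : q < 1) (a b : ℝ) (ha1 : a < 1) (n x y : ℕ)
    (h : n ≤ x + y) :
    qHahn a b (x + y) q n x = ∑ j ∈ range (n + 1), tt a b n x y j q := by
  set B := a * b * q ^ ((n : ℤ) - 1) with hB
  have hxy : q ^ ((x : ℤ) - ((x + y : ℕ) : ℤ)) = q ^ (-(y : ℤ)) := by congr 1; push_cast; ring
  have s1 : qHahn a b (x + y) q n x = ∑ k ∈ range (n + 1), ∑ j ∈ range (n + 1),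
      (((-1) ^ j * q ^ (j.choose 2)) * (∏ i ∈ range j, (B - a * q ^ i)) / qPoch q a j) *
      (qPoch q (q ^ (-(n : ℤ))) k * qPoch q (q ^ (-(y : ℤ))) k /
      (qPoch q (q ^ (-((x + y : ℕ) : ℤ))) k * qPoch q q k) * q ^ k * gb q k j) := by
    unfold qHahn
    refine sum_congr rfl fun k hk => ?_
    have hk := mem_range.1 hk
    have cv := qcv1 hq0 hq1 B k a ha1
    have ext : ∑ j ∈ range (k + 1), gb q k j * ((-1) ^ j * q ^ (j.choose 2)) *
      (∏ i ∈ range j, (B - a * q ^ i)) / qPoch q a j =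
      ∑ j ∈ range (n + 1), gb q k j * ((-1) ^ j * q ^ (j.choose 2)) *
      (∏ i ∈ range j, (B - a * q ^ i)) / qPoch q a j := by
      refine sum_subset (range_subset_range.2 (by omega)) fun j _ hj => ?_
      rw [gb_eq_zero q k j (by simpa using hj)]; simp
    rw [ext] at cv
    rw [hxy, ← hB]
    have : qPoch q (q ^ (-(n : ℤ))) k * qPoch q B k * qPoch q (q ^ (-(y : ℤ))) k /
      (qPoch q a k * qPoch q (q ^ (-((x + y : ℕ) : ℤ))) k * qPoch q q k) * q ^ k =
      (qPoch q (q ^ (-(n : ℤ))) k * qPoch q (q ^ (-(y : ℤ))) k /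
      (qPoch q (q ^ (-((x + y : ℕ) : ℤ))) k * qPoch q q k) * q ^ k) *
        (qPoch q B k / qPoch q a k) := by
      simp only [div_eq_mul_inv, mul_inv]; ring
    rw [this, ← cv, mul_sum]
    exact sum_congr rfl fun j _ => by ring
  rw [s1, sum_comm]
  refine sum_congr rfl fun j hj => ?_
  have hj : j ≤ n := by have := mem_range.1 hj; omega
  rw [← mul_sum, hB, P_eq hq0 a b n j hj]
  obtain ⟨p, rfl⟩ := Nat.exists_eq_add_of_le hj
  rw [qHahn_inner_sum hq0 hq1 x y j p h]
  unfold tt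
  rw [Nat.add_sub_cancel_left]
  simp only [qPoch_neg' hq0]
  rcases lt_or_ge x p with hx | hx
  · rw [rr_eq_zero q hx]; simp
  obtain ⟨d, rfl⟩ := Nat.exists_eq_add_of_le hx
  have id := pow_id hq0 j p d y
  rw [show j + (p + d) - (j + p) = d by omega]
  have n1 := rr_ne_zero hq0 hq1 h
  have n2 := qPoch_ne_zero hq0 hq1 hq1 j
  have n3 := qPoch_ne_zero hq0 hq1 ha1 j
  have n4 : (q ^ ((j + p).choose 2) * (q⁻¹ ^ (p + d + y)) ^ (j + p)) ≠ 0 := by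
    have := hq0.ne'; positivity
  have : q ^ (j.choose 2 + j * d) = q ^ (j.choose 2) * q ^ (j.choose 2) *
      (q ^ (j.choose 2) * (q⁻¹ ^ (j + p)) ^ j) *
      (q ^ (j.choose 2) * (q⁻¹ ^ y) ^ j) * q ^ j *
      ((q ^ j * q⁻¹ ^ y) ^ p * (q ^ (p.choose 2) * (q⁻¹ ^ (p + d)) ^ p)) /
      (q ^ ((j + p).choose 2) * (q⁻¹ ^ (p + d + y)) ^ (j + p)) := by
    rw [id, mul_div_cancel_right₀ _ n4]
  rw [this]
  simp only [div_eq_mul_inv, mul_inv]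
  ring

lemma rr_at_zero {m k : ℕ} (h : k ≤ m) : rr 0 m k = (-1) ^ k := by
  unfold rr
  rw [← card_range k, ← prod_const, card_range]
  refine prod_congr rfl fun i hi => ?_
  have := mem_range.1 hi
  rw [zero_pow (by omega)]; simp

lemma qPoch_at_zero_ne {a : ℝ} (ha : a < 1) (k : ℕ) : qPoch 0 a k ≠ 0 := by
  refine prod_ne_zero_iff.2 fun j _ => ?_
  rcases j with _ | j
  · simp; linarith
  · simp

lemma tt_tendsto (a b : ℝ) (ha1 : a < 1) (n x y j : ℕ) (h : n ≤ x + y) :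
    ContinuousAt (tt a b n x y j) 0 := by
  have n1 : rr 0 (x + y) n ≠ 0 := by rw [rr_at_zero h]; positivity
  have n2 := mul_ne_zero (qPoch_at_zero_ne ha1 j) (qPoch_at_zero_ne one_pos j)
  have c1 : ∀ m k, ContinuousAt (fun q => rr q m k) 0 := by
    intro m k; unfold rr; fun_prop
  have c2 : ∀ k, ContinuousAt (fun q => qPoch q a k) 0 := by
    intro k; unfold qPoch; fun_prop
  have c3 : ∀ k, ContinuousAt (fun q : ℝ => qPoch q q k) 0 := by
    intro k; unfold qPoch; fun_prop
  have c4 : ContinuousAt (fun q : ℝ => ∏ i ∈ range j, (a * b * q ^ (n - 1 - i) - a)) 0 := by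
    fun_prop
  have c5 : ContinuousAt (fun q : ℝ => (-1 : ℝ) ^ j * q ^ (j.choose 2 + j * (j + x - n))) 0 := by
    fun_prop
  unfold tt
  exact (((((c5.mul (c1 n j)).mul (c1 y j)).mul (c1 x (n - j))).div (c1 (x + y) n) n1).mul
    c4).div ((c2 j).mul (c3 j)) n2

lemma tt_two (a b : ℝ) (n x y j : ℕ) : tt a b n x y (j + 2) 0 = 0 := by
  unfold tt
  have : 0 < (j + 2).choose 2 := Nat.choose_pos (by omega)
  rw [zero_pow (by omega)]; simp

lemma tt_sum (a b : ℝ) (ha1 : a < 1) (n x y : ℕ) (h : n ≤ x + y) :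
    ∑ j ∈ range (n + 1), tt a b n x y j 0 = littleZeroJacobi a b n x := by
  rcases n with _ | n
  · simp [tt, littleZeroJacobi, rr, qPoch]
  have hn : 1 - a ≠ 0 := by linarith
  rw [sum_range_succ', sum_range_succ', sum_eq_zero (fun j _ => tt_two a b _ x y j), zero_add]
  have t0 : tt a b (n + 1) x y 0 0 = if n + 1 ≤ x then 1 else 0 := by
    unfold tt
    rw [rr_at_zero h]
    split_ifs with hx
    · rw [Nat.sub_zero, rr_at_zero hx]; simp [rr, qPoch]
    · rw [Nat.sub_zero, rr_eq_zero 0 (by omega : x < n + 1)]; simp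
  have t1 : tt a b (n + 1) x y (0 + 1) 0 = if x = n then (a * b * 0 ^ n - a) / (1 - a) else 0 := by
    unfold tt
    split_ifs with hx
    · subst hx
      rw [rr_at_zero h, rr_at_zero (by omega), rr_at_zero (by omega), rr_at_zero (by omega)]
      have : ((-1 : ℝ)) ^ x ≠ 0 := by positivity
      have e : 1 + x - (x + 1) = 0 := by omega
      simp [qPoch, pow_succ, this, e]
    · rcases lt_or_gt_of_ne hx with hx | hx
      · rw [rr_eq_zero 0 (by omega : x < n + 1 - (0 + 1))]; simp
      · rw [zero_pow (by simp; omega)]; simp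
  rw [t0, t1]
  unfold littleZeroJacobi
  simp only [Nat.add_sub_cancel, Nat.succ_ne_zero, if_false]
  rcases lt_trichotomy x n with hx | hx | hx
  · rw [if_neg (by omega), if_neg (by omega), if_pos hx]; simp
  · subst hx
    rcases x with _ | x
    · simp; ring
    · simp
  · rw [if_neg (by omega), if_pos (by omega), if_neg (by omega), if_neg (by omega)]; simp

theorem qHahn_tendsto_zero (N : ℕ) (hN : 1 ≤ N) (a b : ℝ) (ha0 : 0 < a) (ha1 : a < 1)
    (hb : b < 1) (n x : ℕ) (hn : n ≤ N) (hx : x ≤ N) :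
    Tendsto (fun q : ℝ => qHahn a b N q n x)
      (𝓝[Set.Ioo (0 : ℝ) 1] 0) (𝓝 (littleZeroJacobi a b n x)) := by
  obtain ⟨y, rfl⟩ := Nat.exists_eq_add_of_le hx
  rw [← tt_sum a b ha1 n x y hn]
  have : Tendsto (fun q : ℝ => ∑ j ∈ range (n + 1), tt a b n x y j q)
      (𝓝[Set.Ioo (0 : ℝ) 1] 0) (𝓝 (∑ j ∈ range (n + 1), tt a b n x y j 0)) :=
    tendsto_finsetSum _ fun j _ => (tt_tendsto a b ha1 n x y j hn).tendsto.mono_left nhdsWithin_le_nhds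
  refine this.congr' ?_
  filter_upwards [self_mem_nhdsWithin] with q hq
  exact (qHahn_eq hq.1 hq.2 a b ha1 n x y hn).symm
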